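/- arXiv:math/0608132 — 11 statements merged into one kernel-verified Lean document; each statement's English description precedes it below -/
import Mathlib

section
/- With ζ(p) denoting the unique root in [0,1) of z = 1 − p + p·z^σ for p ∈ (1/σ, 1], one has lim_{p → (1/σ)⁺} (1 − ζ(p))/(p − 1/σ) = 2σ/(σ−1). -/
/-- The polynomial `∑_{i < n} ∑_{j < i} z ^ j`, the quotient of `n - ∑_{i < n} z ^ i`
by `1 - z`. -/
noncomputable def geomDeficit (n : ℕ) (z : ℝ) : ℝ :=
  ∑ i ∈ Finset.range n, ∑ j ∈ Finset.range i, z ^ j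

theorem one_sub_mul_geomDeficit (n : ℕ) (z : ℝ) :
    (1 - z) * geomDeficit n z = n - ∑ i ∈ Finset.range n, z ^ i := by
  simp only [geomDeficit, Finset.mul_sum (Finset.range n), mul_neg_geom_sum,
    Finset.sum_sub_distrib, Finset.sum_const, Finset.card_range, nsmul_eq_mul, mul_one]

theorem geomDeficit_one (n : ℕ) : geomDeficit n 1 = n * (n - 1) / 2 := by
  induction n with
  | zero => simp [geomDeficit]
  | succ k ih =>
    have h : geomDeficit (k + 1) 1 = geomDeficit k 1 + k := by
      simp [geomDeficit, Finset.sum_range_succ]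
    rw [h, ih]
    push_cast
    ring

theorem one_le_geomDeficit {n : ℕ} (hn : 2 ≤ n) {z : ℝ} (hz : 0 ≤ z) :
    1 ≤ geomDeficit n z := by
  have h := Finset.single_le_sum (f := fun i => ∑ j ∈ Finset.range i, z ^ j)
    (fun i _ => Finset.sum_nonneg fun j _ => pow_nonneg hz j)
    (Finset.mem_range.2 (show 1 < n by omega))
  simpa [geomDeficit] using h

theorem continuous_geomDeficit (n : ℕ) : Continuous (geomDeficit n) := by
  unfold geomDeficit
  fun_prop

/-- A root `z ≠ 1` of `z = 1 - p + p * z ^ n` satisfies the equation obtained by dividing out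
the factor `1 - z` of the trivial root. -/
theorem one_sub_mul_geomDeficit_of_root {n : ℕ} {p z : ℝ} (hz : z ≠ 1)
    (h : z = 1 - p + p * z ^ n) : (1 - z) * geomDeficit n z = n - 1 / p := by
  have hg := mul_neg_geom_sum z n
  have hS : p * ∑ i ∈ Finset.range n, z ^ i = 1 := by
    apply mul_left_cancel₀ (sub_ne_zero.2 hz.symm)
    linear_combination p * hg + h
  rw [one_sub_mul_geomDeficit, eq_one_div_of_mul_eq_one_right hS]

open Filter Topology in
/-- With `ζ p` the unique root in `[0,1)` of `z = 1 - p + p * z ^ σ` for `p ∈ (1/σ, 1]`,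
one has `lim_{p → (1/σ)⁺} (1 - ζ p)/(p - 1/σ) = 2σ/(σ-1)`. -/
theorem stmt_1 (σ : ℕ) (hσ : 2 ≤ σ) (ζ : ℝ → ℝ)
    (hζ : ∀ p : ℝ, 1 / (σ : ℝ) < p → p ≤ 1 →
      ζ p ∈ Set.Ico (0 : ℝ) 1 ∧ ζ p = 1 - p + p * (ζ p) ^ σ) :
    Filter.Tendsto (fun p : ℝ => (1 - ζ p) / (p - 1 / (σ : ℝ)))
      (nhdsWithin (1 / (σ : ℝ)) (Set.Ioi (1 / (σ : ℝ))))
      (nhds (2 * (σ : ℝ) / ((σ : ℝ) - 1))) := by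
  have hσ' : (2 : ℝ) ≤ σ := by exact_mod_cast hσ
  have hσ0 : (σ : ℝ) ≠ 0 := by positivity
  have hc : (0 : ℝ) < 1 / σ := by positivity
  have hroot : ∀ᶠ p in 𝓝[>] (1 / (σ : ℝ)),
      1 / (σ : ℝ) < p ∧ 0 ≤ ζ p ∧ ζ p < 1 ∧ (1 - ζ p) * geomDeficit σ (ζ p) = σ - 1 / p := by
    have h1 : 1 / (σ : ℝ) < 1 := by rw [div_lt_one] <;> linarith
    filter_upwards [Ioc_mem_nhdsGT h1] with p hp
    obtain ⟨⟨h0, hlt⟩, he⟩ := hζ p hp.1 hp.2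
    exact ⟨hp.1, h0, hlt, one_sub_mul_geomDeficit_of_root hlt.ne he⟩
  have hid : Tendsto (fun p : ℝ => p) (𝓝[>] (1 / (σ : ℝ))) (𝓝 (1 / (σ : ℝ))) :=
    tendsto_nhdsWithin_of_tendsto_nhds tendsto_id
  have hζ1 : Tendsto ζ (𝓝[>] (1 / (σ : ℝ))) (𝓝 1) := by
    have hlow : Tendsto (fun p : ℝ => 1 - (σ - 1 / p)) (𝓝[>] (1 / (σ : ℝ))) (𝓝 1) := by
      have h := (((tendsto_const_nhds (x := (1 : ℝ))).div hid hc.ne').const_sub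
        (σ : ℝ)).const_sub 1
      simpa using h
    refine tendsto_of_tendsto_of_tendsto_of_le_of_le' hlow tendsto_const_nhds ?_ ?_
    · filter_upwards [hroot] with p ⟨_, h0, hlt, he⟩
      nlinarith [one_le_geomDeficit hσ h0]
    · filter_upwards [hroot] with p hp using hp.2.2.1.le
  have hQ : Tendsto (fun p => geomDeficit σ (ζ p)) (𝓝[>] (1 / (σ : ℝ)))
      (𝓝 (σ * (σ - 1) / 2)) := by
    rw [← geomDeficit_one]
    exact ((continuous_geomDeficit σ).tendsto 1).comp hζ1
  have hσ1 : (σ : ℝ) - 1 ≠ 0 := by linarith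
  have hlim := (tendsto_const_nhds (x := (σ : ℝ))).div (hid.mul hQ) (by positivity)
  have hval : (σ : ℝ) / (1 / σ * (σ * (σ - 1) / 2)) = 2 * σ / (σ - 1) := by
    field_simp
  rw [hval] at hlim
  refine hlim.congr' ?_
  filter_upwards [hroot] with p ⟨hp, h0, _, he⟩
  have hp0 : p ≠ 0 := (hc.trans hp).ne'
  have hQ0 : geomDeficit σ (ζ p) ≠ 0 := by linarith [one_le_geomDeficit hσ h0]
  have hd : p - 1 / (σ : ℝ) ≠ 0 := (sub_pos.2 hp).ne'
  rw [Pi.div_apply, div_eq_div_iff (mul_ne_zero hp0 hQ0) hd]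
  have e1 : (σ : ℝ) * (p - 1 / σ) = σ * p - 1 := by field_simp
  have e2 : p * (σ - 1 / p) = σ * p - 1 := by field_simp
  linear_combination e1 - e2 - p * he
end

section
/- For every p ∈ (1/σ, 1), one has 1 − p·σ·ζ(p)^{σ−1} > 0, and the function ζ is differentiable at p with derivative ζ'(p) = −(1 − ζ(p)^σ)/(1 − p·σ·ζ(p)^{σ−1}). -/
/-- The geometric sum `∑ i < n, z ^ i` with `n ≥ 2` expands distances on `[0, ∞)`. -/
theorem abs_sub_le_abs_geom_sum_sub {n : ℕ} (hn : 2 ≤ n) {x y : ℝ} (hx : 0 ≤ x) (hy : 0 ≤ y) :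
    |x - y| ≤ |∑ i ∈ Finset.range n, x ^ i - ∑ i ∈ Finset.range n, y ^ i| := by
  wlog h : y ≤ x generalizing x y
  · rw [abs_sub_comm x, abs_sub_comm (∑ i ∈ Finset.range n, x ^ i)]
    exact this hy hx (le_of_not_ge h)
  have key : x - y ≤ ∑ i ∈ Finset.range n, (x ^ i - y ^ i) := by
    have := Finset.single_le_sum (f := fun i ↦ x ^ i - y ^ i) (s := Finset.range n)
      (fun i _ ↦ sub_nonneg.2 (pow_le_pow_left₀ hy h i)) (Finset.mem_range.2 hn)
    simpa using this
  rw [Finset.sum_sub_distrib] at key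
  rw [abs_of_nonneg (sub_nonneg.2 h)]
  exact key.trans (le_abs_self _)

/-- On `[0, 1)` the smallest term of the geometric sum is below its average. -/
theorem mul_pow_pred_lt_geom_sum {n : ℕ} (hn : 2 ≤ n) {z : ℝ} (h0 : 0 ≤ z) (h1 : z < 1) :
    (n : ℝ) * z ^ (n - 1) < ∑ i ∈ Finset.range n, z ^ i := by
  have : ∑ _i ∈ Finset.range n, z ^ (n - 1) < ∑ i ∈ Finset.range n, z ^ i := by
    refine Finset.sum_lt_sum (fun i hi ↦ ?_) ⟨0, Finset.mem_range.2 (by omega), ?_⟩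
    · have := Finset.mem_range.1 hi
      exact pow_le_pow_of_le_one h0 h1.le (by omega)
    · simpa using pow_lt_one₀ h0 h1 (by omega : n - 1 ≠ 0)
  simpa using this

/-- A solution `z ≠ 1` of `z = 1 - p + p * z ^ n` satisfies `p * ∑ i < n, z ^ i = 1`. -/
theorem mul_geom_sum_eq_one {n : ℕ} {p z : ℝ} (h1 : z < 1) (h : z = 1 - p + p * z ^ n) :
    p * ∑ i ∈ Finset.range n, z ^ i = 1 := by
  have hg := geom_sum_mul z n
  refine mul_right_cancel₀ (sub_ne_zero.2 h1.ne) ?_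
  rw [mul_assoc, hg]
  linarith

/-- For every `p ∈ (1/σ, 1)`, one has `1 - p·σ·ζ(p)^(σ-1) > 0`, and `ζ` is differentiable
at `p` with derivative `ζ'(p) = -(1 - ζ(p)^σ)/(1 - p·σ·ζ(p)^(σ-1))`. -/
theorem stmt_2 (σ : ℕ) (hσ : 2 ≤ σ) (ζ : ℝ → ℝ)
    (hζ : ∀ p : ℝ, 1 / (σ : ℝ) < p → p ≤ 1 →
      ζ p ∈ Set.Ico (0 : ℝ) 1 ∧ ζ p = 1 - p + p * (ζ p) ^ σ) :
    ∀ p : ℝ, 1 / (σ : ℝ) < p → p < 1 →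
      0 < 1 - p * (σ : ℝ) * (ζ p) ^ (σ - 1) ∧
      HasDerivAt ζ (-(1 - (ζ p) ^ σ) / (1 - p * (σ : ℝ) * (ζ p) ^ (σ - 1))) p := by
  intro p hp hp1
  have hp0 : 0 < p := lt_of_le_of_lt (by positivity) hp
  obtain ⟨⟨hz0, hz1⟩, hz⟩ := hζ p hp hp1.le
  have hpos : 0 < 1 - p * (σ : ℝ) * (ζ p) ^ (σ - 1) := by
    have h := mul_lt_mul_of_pos_left (mul_pow_pred_lt_geom_sum hσ hz0 hz1) hp0
    rw [mul_geom_sum_eq_one hz1 hz] at h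
    linarith
  refine ⟨hpos, ?_⟩
  have hnear : ∀ᶠ q in nhds p, 1 / (σ : ℝ) < q ∧ q < 1 := Ioo_mem_nhds hp hp1
  have hcont : ContinuousAt ζ p := by
    have hlim : Filter.Tendsto (fun q : ℝ ↦ |q⁻¹ - p⁻¹|) (nhds p) (nhds 0) := by
      have := ((continuousAt_inv₀ hp0.ne').sub_const p⁻¹).abs
      simpa [ContinuousAt] using this
    rw [ContinuousAt, tendsto_iff_dist_tendsto_zero]
    refine squeeze_zero' (Filter.Eventually.of_forall fun _ ↦ dist_nonneg) ?_ hlim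
    filter_upwards [hnear] with q hq
    obtain ⟨⟨hw0, hw1⟩, hw⟩ := hζ q hq.1 hq.2.le
    rw [Real.dist_eq, ← eq_inv_of_mul_eq_one_right (mul_geom_sum_eq_one hw1 hw),
      ← eq_inv_of_mul_eq_one_right (mul_geom_sum_eq_one hz1 hz)]
    exact abs_sub_le_abs_geom_sum_sub hσ hw0 hz0
  have hne : ∀ {z : ℝ}, 0 ≤ z → z < 1 → 0 < 1 - z ^ σ := fun h0 h1 ↦
    sub_pos.2 (pow_lt_one₀ h0 h1 (by omega))
  have hd := hne hz0 hz1
  have hinv : HasDerivAt (fun z : ℝ ↦ (1 - z) / (1 - z ^ σ))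
      (-(1 - p * (σ : ℝ) * (ζ p) ^ (σ - 1)) / (1 - (ζ p) ^ σ)) (ζ p) := by
    refine (((hasDerivAt_id (ζ p)).const_sub 1).div ((hasDerivAt_pow σ (ζ p)).const_sub 1)
      hd.ne').congr_deriv ?_
    have h1z : 1 - ζ p = p * (1 - ζ p ^ σ) := by linarith
    simp only [id, h1z]
    field_simp
    ring
  refine (HasDerivAt.of_local_left_inverse hcont hinv
    (div_ne_zero (neg_ne_zero.2 hpos.ne') hd.ne') ?_).congr_deriv ?_
  · filter_upwards [hnear] with q hq
    obtain ⟨⟨hw0, hw1⟩, hw⟩ := hζ q hq.1 hq.2.le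
    rw [div_eq_iff (hne hw0 hw1).ne']
    linarith
  · rw [inv_div, div_neg, neg_div]
end

section
/- The dual parameter p̂(p) = p·ζ(p)^{σ−1} is strictly decreasing on (1/σ, 1], satisfies p̂(1) = 0, and satisfies p̂(p) < 1/σ for every p ∈ (1/σ, 1]. -/
/-- For fixed positive `n`, the ratio `x ^ n / (1 + x + ⋯ + x ^ n)` is strictly increasing
in `x ≥ 0`; stated without division. -/
lemma pow_mul_geom_sum_lt {a b : ℝ} {n : ℕ} (hn : n ≠ 0) (ha : 0 ≤ a) (hab : a < b) :
    a ^ n * ∑ i ∈ Finset.range (n + 1), b ^ i < b ^ n * ∑ i ∈ Finset.range (n + 1), a ^ i := by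
  rw [Finset.mul_sum, Finset.mul_sum]
  refine Finset.sum_lt_sum (fun i hi => ?_) ⟨0, by simp, by simpa using pow_lt_pow_left₀ hab ha hn⟩
  obtain ⟨k, rfl⟩ := Nat.exists_eq_add_of_le (Nat.lt_succ_iff.mp (Finset.mem_range.mp hi))
  have hb : 0 ≤ b := ha.trans hab.le
  calc a ^ (i + k) * b ^ i = a ^ i * b ^ i * a ^ k := by ring
    _ ≤ a ^ i * b ^ i * b ^ k := by gcongr
    _ = b ^ (i + k) * a ^ i := by ring

/-- A fixed point `z ≠ 1` of `z ↦ 1 - p + p * z ^ m` satisfies `p * (1 + z + ⋯ + z ^ (m - 1)) = 1`. -/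
lemma mul_geom_sum_eq_one_of_fixed {p z : ℝ} {m : ℕ} (hz : z ≠ 1) (h : z = 1 - p + p * z ^ m) :
    p * ∑ i ∈ Finset.range m, z ^ i = 1 := by
  apply mul_right_cancel₀ (sub_ne_zero.mpr hz)
  rw [mul_assoc, geom_sum_mul]
  linarith

/-- The dual parameter `p̂(p) = p·ζ(p)^(σ-1)` is strictly decreasing on `(1/σ, 1]`,
satisfies `p̂(1) = 0`, and satisfies `p̂(p) < 1/σ` for every `p ∈ (1/σ, 1]`. -/
theorem stmt_3 (σ : ℕ) (hσ : 2 ≤ σ) (ζ : ℝ → ℝ)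
    (hζ : ∀ p : ℝ, 1 / (σ : ℝ) < p → p ≤ 1 →
      ζ p ∈ Set.Ico (0 : ℝ) 1 ∧ ζ p = 1 - p + p * (ζ p) ^ σ) :
    StrictAntiOn (fun p : ℝ => p * (ζ p) ^ (σ - 1)) (Set.Ioc (1 / (σ : ℝ)) 1) ∧
    (1 : ℝ) * (ζ 1) ^ (σ - 1) = 0 ∧
    ∀ p : ℝ, 1 / (σ : ℝ) < p → p ≤ 1 → p * (ζ p) ^ (σ - 1) < 1 / (σ : ℝ) := by
  obtain ⟨n, rfl⟩ : ∃ n, σ = n + 1 := ⟨σ - 1, by omega⟩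
  have hn : n ≠ 0 := by omega
  simp only [Nat.add_sub_cancel]
  have hσ_pos : (0 : ℝ) < ((n + 1 : ℕ) : ℝ) := by positivity
  have key (p : ℝ) (h₁ : 1 / ((n + 1 : ℕ) : ℝ) < p) (h₂ : p ≤ 1) :
      0 < p ∧ 0 ≤ ζ p ∧ ζ p < 1 ∧ p * ∑ i ∈ Finset.range (n + 1), ζ p ^ i = 1 := by
    obtain ⟨⟨h₀, h_lt⟩, h⟩ := hζ p h₁ h₂
    exact ⟨(one_div_pos.mpr hσ_pos).trans h₁, h₀, h_lt, mul_geom_sum_eq_one_of_fixed h_lt.ne h⟩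
  refine ⟨?_, ?_, ?_⟩
  · rintro p ⟨hp₁, hp₂⟩ q ⟨hq₁, hq₂⟩ hpq
    obtain ⟨hp, hzp, -, hSp⟩ := key p hp₁ hp₂
    obtain ⟨hq, hzq, -, hSq⟩ := key q hq₁ hq₂
    have hz : ζ q < ζ p := by
      by_contra! hle
      have hS : ∑ i ∈ Finset.range (n + 1), ζ p ^ i ≤ ∑ i ∈ Finset.range (n + 1), ζ q ^ i := by
        gcongr
      have hS_pos : 0 < ∑ i ∈ Finset.range (n + 1), ζ q ^ i :=
        pos_of_mul_pos_right (hSq.symm ▸ one_pos) hq.le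
      exact ((mul_le_mul_of_nonneg_left hS hp.le).trans_lt
        (mul_lt_mul_of_pos_right hpq hS_pos)).ne (hSp.trans hSq.symm)
    have h := mul_lt_mul_of_pos_left (pow_mul_geom_sum_lt hn hzq hz) (mul_pos hp hq)
    calc q * ζ q ^ n = q * ζ q ^ n * (p * ∑ i ∈ Finset.range (n + 1), ζ p ^ i) := by
          rw [hSp, mul_one]
      _ = p * q * (ζ q ^ n * ∑ i ∈ Finset.range (n + 1), ζ p ^ i) := by ring
      _ < p * q * (ζ p ^ n * ∑ i ∈ Finset.range (n + 1), ζ q ^ i) := h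
      _ = p * ζ p ^ n * (q * ∑ i ∈ Finset.range (n + 1), ζ q ^ i) := by ring
      _ = p * ζ p ^ n := by rw [hSq, mul_one]
  · have h_one : 1 / ((n + 1 : ℕ) : ℝ) < 1 := by
      rw [div_lt_one hσ_pos]
      exact_mod_cast hσ
    obtain ⟨⟨h₀, h_lt⟩, h⟩ := hζ 1 h_one le_rfl
    have hz : ζ 1 = 0 := by
      by_contra hne
      have := pow_lt_self_of_lt_one₀ (lt_of_le_of_ne h₀ (Ne.symm hne)) h_lt hσ
      linarith
    simp [hz, hn]
  · intro p h₁ h₂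
    obtain ⟨hp, hz, hz₁, hS⟩ := key p h₁ h₂
    have h := mul_lt_mul_of_pos_left (pow_mul_geom_sum_lt hn hz hz₁) hp
    simp only [one_pow, one_mul, Finset.sum_const, Finset.card_range, nsmul_eq_mul, mul_one,
      hS] at h
    rw [lt_div_iff₀ hσ_pos]
    linarith
end

section
/- For every integer σ ≥ 2 and every x ∈ [0,1], one has (σ+1)·x^σ + (σ−1) ≥ (σ−1)·x^{σ+1} + (σ+1)·x; equivalently, the polynomial G(x) = −(σ−1)x^{σ+1} + (σ+1)x^σ − (σ+1)x + (σ−1) is nonnegative on [0,1]. -/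
/-- For every integer `σ ≥ 2` and every `x ∈ [0,1]`, one has
`(σ+1)·x^σ + (σ-1) ≥ (σ-1)·x^(σ+1) + (σ+1)·x`; equivalently, the polynomial
`G(x) = -(σ-1)x^(σ+1) + (σ+1)x^σ - (σ+1)x + (σ-1)` is nonnegative on `[0,1]`. -/
theorem stmt_6 (σ : ℕ) (hσ : 2 ≤ σ) :
    ∀ x : ℝ, x ∈ Set.Icc (0 : ℝ) 1 →
      ((σ : ℝ) - 1) * x ^ (σ + 1) + ((σ : ℝ) + 1) * x ≤ ((σ : ℝ) + 1) * x ^ σ + ((σ : ℝ) - 1) := by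
  rintro x ⟨hx0, hx1⟩
  induction σ, hσ using Nat.le_induction with
  | base =>
    have h : 0 ≤ (1 - x) ^ 3 := pow_nonneg (sub_nonneg.2 hx1) 3
    norm_num
    linarith
  | succ n _ ih =>
    have bernoulli : 1 + ((n + 1 : ℕ) : ℝ) * (x - 1) ≤ (1 + (x - 1)) ^ (n + 1) :=
      one_add_mul_le_pow (by linarith) (n + 1)
    rw [add_sub_cancel] at bernoulli
    have h₁ := mul_le_mul_of_nonneg_left bernoulli (sub_nonneg.2 hx1)
    have h₂ := mul_le_mul_of_nonneg_left ih hx0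
    push_cast at h₁ ⊢
    ring_nf at h₁ h₂ ⊢
    linarith
end

section
/- For every integer σ ≥ 2, the function F(x) = (1−x)/(1−x^σ) is convex on the interval [0,1). -/
/-- The weighted AM-GM type inequality `(n + 1) x ≤ n + x ^ (n + 1)` on the nonnegative reals. -/
lemma natCast_sub_mul_add_pow_nonneg (n : ℕ) {x : ℝ} (hx : 0 ≤ x) :
    0 ≤ (n : ℝ) - (n + 1) * x + x ^ (n + 1) := by
  have h := one_add_mul_le_pow (show (-2 : ℝ) ≤ x - 1 by linarith) (n + 1)
  rw [add_sub_cancel] at h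
  push_cast at h
  linarith

lemma natCast_sub_mul_add_mul_pow_sub_nonneg (n : ℕ) {x : ℝ} (hx : 0 ≤ x) (hx1 : x ≤ 1) :
    0 ≤ (n : ℝ) - (n + 2) * x + (n + 2) * x ^ (n + 1) - n * x ^ (n + 2) := by
  induction n with
  | zero => simp
  | succ n ih =>
    have h := mul_nonneg (sub_nonneg.2 hx1) (natCast_sub_mul_add_pow_nonneg (n + 1) hx)
    have h' := mul_nonneg hx ih
    push_cast at h ⊢
    refine (add_nonneg h h').trans_eq ?_
    ring

/-- For every integer `σ ≥ 2`, the function `F(x) = (1-x)/(1-x^σ)` is convex on `[0,1)`. -/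
theorem stmt_7 (σ : ℕ) (hσ : 2 ≤ σ) :
    ConvexOn ℝ (Set.Ico (0 : ℝ) 1) (fun x : ℝ => (1 - x) / (1 - x ^ σ)) := by
  obtain ⟨k, rfl⟩ := Nat.exists_eq_add_of_le' hσ
  have hpos : ∀ x ∈ Set.Ico (0 : ℝ) 1, 0 < 1 - x ^ (k + 2) := fun x hx =>
    sub_pos.2 (pow_lt_one₀ hx.1 hx.2 (by omega))
  have hmem : ∀ x ∈ interior (Set.Ico (0 : ℝ) 1), x ∈ Set.Ico (0 : ℝ) 1 := fun x hx =>
    interior_subset hx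
  have hlin : ∀ x : ℝ, HasDerivAt (fun x : ℝ => 1 - x) (-1) x := fun x =>
    (hasDerivAt_id x).const_sub 1
  have hden : ∀ x : ℝ, HasDerivAt (fun x : ℝ => 1 - x ^ (k + 2)) (-((k + 2) * x ^ (k + 1))) x :=
    fun x => by simpa using (hasDerivAt_pow (k + 2) x).const_sub 1
  refine convexOn_of_hasDerivWithinAt2_nonneg (convex_Ico 0 1)
    (f' := fun x => (-(1 - x ^ (k + 2)) + (1 - x) * ((k + 2) * x ^ (k + 1))) /
      (1 - x ^ (k + 2)) ^ 2)
    (f'' := fun x => (k + 2) * x ^ k * (((k + 1 : ℕ) : ℝ) - ((k + 1 : ℕ) + 2) * x +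
      ((k + 1 : ℕ) + 2) * x ^ (k + 1 + 1) - (k + 1 : ℕ) * x ^ (k + 1 + 2)) /
      (1 - x ^ (k + 2)) ^ 3) ?_ ?_ ?_ ?_
  · exact ContinuousOn.div (by fun_prop) (by fun_prop) fun x hx => (hpos x hx).ne'
  · intro x hx
    refine (((hlin x).fun_div (hden x) (hpos x (hmem x hx)).ne').congr_deriv ?_).hasDerivWithinAt
    ring
  · intro x hx
    have hne := (hpos x (hmem x hx)).ne'
    have hpow : HasDerivAt (fun x : ℝ => ((k : ℝ) + 2) * x ^ (k + 1))
        ((k + 2) * ((k + 1) * x ^ k)) x := by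
      simpa using (hasDerivAt_pow (k + 1) x).const_mul ((k : ℝ) + 2)
    refine ((((hden x).fun_neg.fun_add ((hlin x).fun_mul hpow)).fun_div ((hden x).fun_pow 2)
      (pow_ne_zero 2 hne)).congr_deriv ?_).hasDerivWithinAt
    rw [div_eq_div_iff (by positivity) (by positivity)]
    push_cast
    ring
  · intro x hx
    have hx' := hmem x hx
    have h := natCast_sub_mul_add_mul_pow_sub_nonneg (k + 1) hx'.1 hx'.2.le
    have hd := hpos x hx'
    have hxk := pow_nonneg hx'.1 k
    exact div_nonneg (mul_nonneg (mul_nonneg (by positivity) hxk) h) (pow_nonneg hd.le 3)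
end

section
/- Let σ ≥ 2 be an integer, δ ∈ (0,1], p = (1−δ)/σ, ρ = (σ−1)/(2σ), and τ ∈ [0,1]. Define g_0 = 1 − e^{−τ/σ}, g_{m+1} = p·(1 − (1 − g_m)^σ), and g̃(t) = g_0·e^{−δt} / (1 + ((1−δ)ρσ/δ)·g_0·(1 − e^{−δt})). Then for every m ∈ ℕ: −(δτ + τ²/2)/σ ≤ g_m − g̃(m) ≤ m·τ³/(6σ). -/
theorem one_sub_pow_le_quadratic {y : ℝ} (hy0 : 0 ≤ y) (hy1 : y ≤ 1) (n : ℕ) :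
    (1 - y) ^ n ≤ 1 - n * y + n * (n - 1) / 2 * y ^ 2 := by
  induction n with
  | zero => simp
  | succ n ih =>
    have h := mul_le_mul_of_nonneg_right ih (sub_nonneg.2 hy1)
    have hC : (0 : ℝ) ≤ n * (n - 1) := by
      rcases n with _ | n
      · simp
      · push_cast
        have : (0 : ℝ) ≤ n := n.cast_nonneg
        nlinarith
    have h3 := mul_nonneg hC (pow_nonneg hy0 3)
    rw [pow_succ (1 - y) n]
    push_cast
    nlinarith

theorem cubic_le_one_sub_pow {y : ℝ} (hy0 : 0 ≤ y) (hy1 : y ≤ 1) (n : ℕ) :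
    1 - n * y + n * (n - 1) / 2 * y ^ 2 - n * (n - 1) * (n - 2) / 6 * y ^ 3 ≤ (1 - y) ^ n := by
  induction n with
  | zero => simp
  | succ n ih =>
    have h := mul_le_mul_of_nonneg_right ih (sub_nonneg.2 hy1)
    have hC : (0 : ℝ) ≤ n * (n - 1) * (n - 2) := by
      rcases n with _ | _ | n
      · simp
      · simp
      · push_cast
        have : (0 : ℝ) ≤ n := n.cast_nonneg
        have e : ((n : ℝ) + 1 + 1) * (n + 1 + 1 - 1) * (n + 1 + 1 - 2) =
          (n + 2) * (n + 1) * n := by ring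
        rw [e]
        positivity
    have h4 := mul_nonneg hC (pow_nonneg hy0 4)
    rw [pow_succ (1 - y) n]
    push_cast
    nlinarith

/-- The unit-time flow of the logistic vector field `-δ x - K x²` lies above the explicit Euler
step and below the implicit one, and decreases. -/
theorem logistic_step_bounds {δ K x : ℝ} (hδ0 : 0 < δ) (hδ1 : δ ≤ 1) (hK : 0 ≤ K) (hx : 0 ≤ x)
    {x' : ℝ}
    (hx' : x' = x * Real.exp (-δ) / (1 + K / δ * x * (1 - Real.exp (-δ)))) :
    0 ≤ x' ∧ x' ≤ x ∧ x - δ * x - K * x ^ 2 ≤ x' ∧ x' + δ * x' + K * x' ^ 2 ≤ x := by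
  set q := Real.exp (-δ) with hq
  have hq0 : 0 < q := Real.exp_pos _
  have hq1 : 1 - δ ≤ q := by have := Real.add_one_le_exp (-δ); linarith
  have hq2 : q * (1 + δ) ≤ 1 := by
    have h1 := Real.add_one_le_exp δ
    have h2 : q * Real.exp δ = 1 := by rw [hq, ← Real.exp_add]; simp
    nlinarith
  obtain ⟨r, hr⟩ : ∃ r, r = (1 - q) / δ := ⟨_, rfl⟩
  have hqr : q = 1 - δ * r := by rw [hr]; field_simp; ring
  have hr1 : r ≤ 1 := by rw [hr, div_le_one hδ0]; linarith
  have hrq : q ≤ r := by rw [hr, le_div_iff₀ hδ0]; linarith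
  have hr0 : 0 < r := hq0.trans_le hrq
  have hKx : 0 ≤ K * x := mul_nonneg hK hx
  obtain ⟨A, hA⟩ : ∃ A, A = 1 + K * x * r := ⟨_, rfl⟩
  have hA1 : 1 ≤ A := by rw [hA]; nlinarith [mul_nonneg hKx hr0.le]
  have hA0 : 0 < A := by linarith
  have hxA : x' = x * q / A := by rw [hx', hA, hr]; congr 2; ring
  have hx'0 : 0 ≤ x' := by rw [hxA]; positivity
  have himp : x' + δ * x' + K * x' ^ 2 ≤ x := by
    have key : q * (1 + δ) * A + K * x * q ^ 2 ≤ A ^ 2 := by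
      have h1 : q * (1 + δ) * A ≤ A := by nlinarith
      have h2 : q ^ 2 ≤ A * r := by nlinarith
      have h3 := mul_le_mul_of_nonneg_left h2 hKx
      have h4 : A ^ 2 = A + K * x * (A * r) := by rw [hA]; ring
      linarith
    have e : x' + δ * x' + K * x' ^ 2 = x * (q * (1 + δ) * A + K * x * q ^ 2) / A ^ 2 := by
      rw [hxA]; field_simp
    rw [e, div_le_iff₀ (by positivity)]
    exact mul_le_mul_of_nonneg_left key hx
  refine ⟨hx'0, ?_, ?_, himp⟩
  · have := mul_nonneg hδ0.le hx'0
    have := mul_nonneg hK (sq_nonneg x')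
    linarith
  · have key : (1 - δ - K * x) * A ≤ q := by
      rw [hA, hqr]
      have h1 : 0 ≤ (δ + K * x) * (1 - r) :=
        mul_nonneg (by linarith) (by linarith)
      have h2 : 0 ≤ K * x * r * (δ + K * x) := by positivity
      linarith
    rw [hxA, le_div_iff₀ hA0]
    have := mul_le_mul_of_nonneg_left key hx
    linarith

/-- The logistic solution composes as a flow: its value at time `t + 1` is the unit-time flow
of its value at time `t`. -/
theorem logistic_flow_add_one {δ K a : ℝ} (hδ0 : 0 < δ) (hK : 0 ≤ K) (ha : 0 ≤ a)
    {t : ℝ} (ht : 0 ≤ t) :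
    let G : ℝ → ℝ := fun s => a * Real.exp (-δ * s) / (1 + K / δ * a * (1 - Real.exp (-δ * s)))
    G (t + 1) = G t * Real.exp (-δ) / (1 + K / δ * G t * (1 - Real.exp (-δ))) := by
  intro G
  have e : Real.exp (-δ * (t + 1)) = Real.exp (-δ * t) * Real.exp (-δ) := by
    rw [← Real.exp_add]; congr 1; ring
  have hE1 : Real.exp (-δ * t) ≤ 1 := Real.exp_le_one_iff.2 (by nlinarith)
  simp only [G, e]
  generalize Real.exp (-δ * t) = E at *
  generalize Real.exp (-δ) = q at *
  obtain ⟨c, hc⟩ : ∃ c, c = K / δ := ⟨_, rfl⟩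
  have hc0 : 0 ≤ c := by rw [hc]; positivity
  rw [← hc]
  have hca := mul_nonneg hc0 ha
  have hD1 : 0 < 1 + c * a * (1 - E) := by
    have := mul_nonneg hca (sub_nonneg.2 hE1)
    linarith
  have h3 : 1 + c * (a * E / (1 + c * a * (1 - E))) * (1 - q) =
      (1 + c * a * (1 - E * q)) / (1 + c * a * (1 - E)) := by
    field_simp
    ring
  rw [h3, div_mul_eq_mul_div, div_div_div_cancel_right₀ hD1.ne', ← mul_assoc]

/-- Let `σ ≥ 2`, `δ ∈ (0,1]`, `p = (1-δ)/σ`, `ρ = (σ-1)/(2σ)`, `τ ∈ [0,1]`. Define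
`g 0 = 1 - e^{-τ/σ}`, `g (m+1) = p·(1 - (1 - g m)^σ)`, and
`g̃ t = g 0 · e^{-δt} / (1 + ((1-δ)ρσ/δ)·(g 0)·(1 - e^{-δt}))`. Then for every `m`:
`-(δτ + τ²/2)/σ ≤ g m - g̃ m ≤ m·τ³/(6σ)`. -/
theorem stmt_9 (σ : ℕ) (hσ : 2 ≤ σ) (δ p ρ τ : ℝ) (hδ : δ ∈ Set.Ioc (0 : ℝ) 1)
    (hp : p = (1 - δ) / (σ : ℝ)) (hρ : ρ = ((σ : ℝ) - 1) / (2 * (σ : ℝ)))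
    (hτ : τ ∈ Set.Icc (0 : ℝ) 1)
    (g : ℕ → ℝ) (hg0 : g 0 = 1 - Real.exp (-τ / (σ : ℝ)))
    (hgrec : ∀ m : ℕ, g (m + 1) = p * (1 - (1 - g m) ^ σ))
    (gt : ℝ → ℝ)
    (hgt : ∀ t : ℝ, gt t = g 0 * Real.exp (-δ * t) /
      (1 + ((1 - δ) * ρ * (σ : ℝ) / δ) * g 0 * (1 - Real.exp (-δ * t)))) :
    ∀ m : ℕ, -((δ * τ + τ ^ 2 / 2) / (σ : ℝ)) ≤ g m - gt m ∧
      g m - gt m ≤ (m : ℝ) * τ ^ 3 / (6 * (σ : ℝ)) := by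
  obtain ⟨hδ0, hδ1⟩ := hδ
  obtain ⟨hτ0, hτ1⟩ := hτ
  have hs : (2 : ℝ) ≤ σ := by exact_mod_cast hσ
  have hs0 : (0 : ℝ) < σ := by linarith
  obtain ⟨K, hKdef⟩ : ∃ K, K = (1 - δ) * ((σ : ℝ) - 1) / 2 := ⟨_, rfl⟩
  have hK : 0 ≤ K := by
    rw [hKdef]; exact div_nonneg (mul_nonneg (by linarith) (by linarith)) (by norm_num)
  have hKρ : (1 - δ) * ρ * (σ : ℝ) = K := by rw [hρ, hKdef]; field_simp
  have hp0 : 0 ≤ p := by rw [hp]; exact div_nonneg (by linarith) hs0.le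
  have hpσ : p * σ = 1 - δ := by rw [hp]; field_simp
  have hpK : p * (σ * (σ - 1) / 2) = K := by rw [hKdef, ← hpσ]; ring
  have hτσ : 0 ≤ τ / σ := by positivity
  have hτσ1 : τ / σ ≤ 1 := by rw [div_le_one hs0]; linarith
  have hg00 : 0 ≤ g 0 := by
    rw [hg0, neg_div]
    have := Real.exp_le_one_iff.2 (neg_nonpos.2 hτσ)
    linarith
  have hg0τ : g 0 ≤ τ / σ := by
    rw [hg0, neg_div]
    have := Real.add_one_le_exp (-(τ / σ))
    linarith
  have hgb : ∀ m, 0 ≤ g m ∧ g m ≤ τ / σ := by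
    intro m
    induction m with
    | zero => exact ⟨hg00, hg0τ⟩
    | succ m ih =>
      obtain ⟨h0, h1⟩ := ih
      rw [hgrec]
      have hle : (1 - g m) ^ σ ≤ 1 := pow_le_one₀ (by linarith) (by linarith)
      have hB : 1 - σ * g m ≤ (1 - g m) ^ σ := by
        have := one_add_mul_le_pow (a := -g m) (by linarith) σ
        rw [← sub_eq_add_neg] at this
        linarith
      refine ⟨mul_nonneg hp0 (by linarith), ?_⟩
      calc p * (1 - (1 - g m) ^ σ) ≤ p * (σ * g m) :=
            mul_le_mul_of_nonneg_left (by linarith) hp0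
        _ = (1 - δ) * g m := by rw [← hpσ]; ring
        _ ≤ τ / σ := by nlinarith
  have hglow : ∀ m, g m - δ * g m - K * g m ^ 2 ≤ g (m + 1) := by
    intro m
    obtain ⟨h0, h1⟩ := hgb m
    have h := mul_le_mul_of_nonneg_left
      (one_sub_pow_le_quadratic h0 (h1.trans hτσ1) σ) hp0
    rw [hgrec, ← hpK]
    linear_combination h - g m * hpσ
  have hgup : ∀ m, g (m + 1) ≤ g m - δ * g m - K * g m ^ 2 + τ ^ 3 / (6 * σ) := by
    intro m
    obtain ⟨h0, h1⟩ := hgb m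
    have h := mul_le_mul_of_nonneg_left
      (cubic_le_one_sub_pow h0 (h1.trans hτσ1) σ) hp0
    have hc : p * (σ * (σ - 1) * (σ - 2) / 6 * g m ^ 3) ≤ τ ^ 3 / (6 * σ) := by
      have h3 : g m ^ 3 ≤ (τ / σ) ^ 3 := pow_le_pow_left₀ h0 h1 3
      have hA : p * (σ * (σ - 1) * (σ - 2) / 6) ≤ σ ^ 2 / 6 := by
        have : (1 - δ) * (((σ : ℝ) - 1) * (σ - 2)) ≤ 1 * σ ^ 2 :=
          mul_le_mul (by linarith) (by nlinarith)
            (mul_nonneg (by linarith) (by linarith)) zero_le_one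
        rw [← hpσ] at this
        linarith
      calc p * (σ * (σ - 1) * (σ - 2) / 6 * g m ^ 3)
          = p * (σ * (σ - 1) * (σ - 2) / 6) * g m ^ 3 := by ring
        _ ≤ σ ^ 2 / 6 * (τ / σ) ^ 3 := mul_le_mul hA h3 (by positivity) (by positivity)
        _ = τ ^ 3 / (6 * σ) := by field_simp
    rw [hgrec, ← hpK]
    linear_combination h + hc + g m * hpσ
  have hgt' : gt = fun s => g 0 * Real.exp (-δ * s) /
      (1 + K / δ * g 0 * (1 - Real.exp (-δ * s))) := by
    funext s; rw [hgt, hKρ]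
  have hgt0 : gt 0 = g 0 := by rw [hgt]; simp
  have hflow : ∀ m : ℕ, gt (m + 1) = gt m * Real.exp (-δ) /
      (1 + K / δ * gt m * (1 - Real.exp (-δ))) := by
    intro m
    rw [hgt']
    exact logistic_flow_add_one hδ0 hK hg00 m.cast_nonneg
  have hgtb : ∀ m : ℕ, 0 ≤ gt m ∧ gt m ≤ g 0 := by
    intro m
    induction m with
    | zero => simp [hgt0, hg00]
    | succ m ih =>
      obtain ⟨h1, h2, -, -⟩ := logistic_step_bounds hδ0 hδ1 hK ih.1 (hflow m)
      push_cast
      exact ⟨h1, h2.trans ih.2⟩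
  have hslope : ∀ x y : ℝ, 0 ≤ x → 0 ≤ y → x ≤ τ / σ → y ≤ τ / σ →
      0 ≤ 1 - δ - K * (x + y) ∧ 1 - δ - K * (x + y) ≤ 1 := by
    intro x y hx hy hx1 hy1
    have hsum := mul_nonneg hK (add_nonneg hx hy)
    refine ⟨?_, by linarith⟩
    have h1 : ((σ : ℝ) - 1) * (x + y) ≤ 2 := by
      have h2 : (σ : ℝ) * (x + y) ≤ σ * (2 * (τ / σ)) :=
        mul_le_mul_of_nonneg_left (by linarith) hs0.le
      have h3 : (σ : ℝ) * (2 * (τ / σ)) = 2 * τ := by field_simp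
      linarith
    have h4 := mul_le_mul_of_nonneg_left h1 (show 0 ≤ (1 - δ) / 2 by linarith)
    rw [hKdef]
    linarith
  have hlower : ∀ m : ℕ, gt m - g m ≤
      (δ * g 0 + K * g 0 ^ 2) - (δ * gt m + K * gt m ^ 2) := by
    intro m
    induction m with
    | zero => simp [hgt0]
    | succ m ih =>
      obtain ⟨a0, a1⟩ := hgtb m
      obtain ⟨b0, b1⟩ := hgb m
      obtain ⟨-, -, -, h4⟩ := logistic_step_bounds hδ0 hδ1 hK a0 (hflow m)
      have h5 := hglow m
      obtain ⟨s0, s1⟩ := hslope (gt m) (g m) a0 b0 (a1.trans hg0τ) b1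
      have hmono : δ * gt m + K * gt m ^ 2 ≤ δ * g 0 + K * g 0 ^ 2 := by gcongr
      have e : (gt m - δ * gt m - K * gt m ^ 2) - (g m - δ * g m - K * g m ^ 2) =
        (1 - δ - K * (gt m + g m)) * (gt m - g m) := by ring
      have hstep : (1 - δ - K * (gt m + g m)) * (gt m - g m) ≤
          (δ * g 0 + K * g 0 ^ 2) - (δ * gt m + K * gt m ^ 2) := by
        rcases le_total 0 (gt m - g m) with h | h
        · exact (mul_le_of_le_one_left h s1).trans ih
        · exact (mul_nonpos_of_nonneg_of_nonpos s0 h).trans (by linarith)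
      push_cast
      linarith
  have hupper : ∀ m : ℕ, g m - gt m ≤ m * (τ ^ 3 / (6 * σ)) := by
    intro m
    induction m with
    | zero => simp [hgt0]
    | succ m ih =>
      obtain ⟨a0, a1⟩ := hgtb m
      obtain ⟨b0, b1⟩ := hgb m
      obtain ⟨-, -, h3, -⟩ := logistic_step_bounds hδ0 hδ1 hK a0 (hflow m)
      have h5 := hgup m
      obtain ⟨s0, s1⟩ := hslope (gt m) (g m) a0 b0 (a1.trans hg0τ) b1
      have e : (g m - δ * g m - K * g m ^ 2) - (gt m - δ * gt m - K * gt m ^ 2) =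
        (1 - δ - K * (gt m + g m)) * (g m - gt m) := by ring
      have hstep : (1 - δ - K * (gt m + g m)) * (g m - gt m) ≤ m * (τ ^ 3 / (6 * σ)) := by
        rcases le_total 0 (g m - gt m) with h | h
        · exact (mul_le_of_le_one_left h s1).trans ih
        · exact (mul_nonpos_of_nonneg_of_nonpos s0 h).trans (by positivity)
      push_cast
      linarith
  intro m
  refine ⟨?_, (hupper m).trans_eq (by ring)⟩
  have h1 := hlower m
  have a0 := (hgtb m).1
  have h2 : 0 ≤ δ * gt m + K * gt m ^ 2 := by positivity
  have h3 : δ * g 0 + K * g 0 ^ 2 ≤ δ * (τ / σ) + K * (τ / σ) ^ 2 := by gcongr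
  have h4 : K * (τ / σ) ^ 2 ≤ τ ^ 2 / 2 / σ := by
    have hKσ : K ≤ σ / 2 := by rw [hKdef]; nlinarith
    calc K * (τ / σ) ^ 2 ≤ σ / 2 * (τ / σ) ^ 2 := by gcongr
      _ = τ ^ 2 / 2 / σ := by field_simp
  have h5 : (δ * τ + τ ^ 2 / 2) / (σ : ℝ) = δ * (τ / σ) + τ ^ 2 / 2 / σ := by ring
  rw [h5]
  linarith
end

section
/- Let σ ≥ 2 be an integer, p ∈ [0, 1/σ], and τ ∈ [0,1]. Define g_0 = 1 − e^{−τ/σ}, g_{m+1} = p·(1 − (1 − g_m)^σ), and ĝ_0 = g_0, ĝ_{m+1} = pσ·(ĝ_m − ((σ−1)/2)·ĝ_m²). Then for every m ∈ ℕ: 0 ≤ g_m − ĝ_m ≤ m·τ³/(6σ). -/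
/-- Truncating the binomial expansion of `(1 - x) ^ n` after one, two or three powers of `x`
alternately under- and overestimates it. -/
theorem one_sub_pow_bonferroni {x : ℝ} (hx0 : 0 ≤ x) (hx1 : x ≤ 1) (n : ℕ) :
    1 - n * x ≤ (1 - x) ^ n ∧
    (1 - x) ^ n ≤ 1 - n * x + n * (n - 1) / 2 * x ^ 2 ∧
    1 - n * x + n * (n - 1) / 2 * x ^ 2 - n * (n - 1) * (n - 2) / 6 * x ^ 3 ≤ (1 - x) ^ n := by
  induction n with
  | zero => simp
  | succ n ih =>
    obtain ⟨h1, h2, h3⟩ := ih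
    have hpow : (1 - x) ^ n ≤ 1 := pow_le_one₀ (by linarith) (by linarith)
    have e : (1 - x) ^ (n + 1) = (1 - x) ^ n - x * (1 - x) ^ n := by ring
    have k0 := mul_le_mul_of_nonneg_left hpow hx0
    have k1 := mul_le_mul_of_nonneg_left h1 hx0
    have k2 := mul_le_mul_of_nonneg_left h2 hx0
    rw [e]
    push_cast
    refine ⟨?_, ?_, ?_⟩ <;> linarith

/-- One step of the comparison between `x ↦ p (1 - (1 - x) ^ σ)` and its second-order Taylor
approximation, on the interval `[0, τ / σ]`. -/
theorem taylor_step_bounds {σ : ℕ} (hσ : 2 ≤ σ) {p τ x y : ℝ} (hp0 : 0 ≤ p) (hp1 : p * σ ≤ 1)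
    (hτ : τ ≤ 1) (hy : 0 ≤ y) (hyx : y ≤ x) (hx : σ * x ≤ τ) :
    0 ≤ p * σ * (y - ((σ : ℝ) - 1) / 2 * y ^ 2) ∧
    p * σ * (y - ((σ : ℝ) - 1) / 2 * y ^ 2) ≤ p * (1 - (1 - x) ^ σ) ∧
    p * (1 - (1 - x) ^ σ) ≤ x ∧
    p * (1 - (1 - x) ^ σ) - p * σ * (y - ((σ : ℝ) - 1) / 2 * y ^ 2) ≤
      (x - y) + τ ^ 3 / (6 * σ) := by
  have hσ2 : (2 : ℝ) ≤ σ := by exact_mod_cast hσ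
  have hx0 : 0 ≤ x := hy.trans hyx
  have hx1 : x ≤ 1 := by nlinarith
  obtain ⟨h1, h2, h3⟩ := one_sub_pow_bonferroni hx0 hx1 σ
  have hq0 : 0 ≤ p * σ := by positivity
  have hd : 0 ≤ x - y := by linarith
  have hs0 : 0 ≤ ((σ : ℝ) - 1) / 2 * (x + y) := by
    apply mul_nonneg <;> linarith
  have hs1 : ((σ : ℝ) - 1) / 2 * (x + y) ≤ 1 := by
    nlinarith [mul_nonneg (show (0 : ℝ) ≤ σ - 1 by linarith) hd]
  have hfac0 : 0 ≤ p * σ * ((x - y) * (1 - ((σ : ℝ) - 1) / 2 * (x + y))) :=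
    mul_nonneg hq0 (mul_nonneg hd (by linarith))
  have hfac1 : p * σ * ((x - y) * (1 - ((σ : ℝ) - 1) / 2 * (x + y))) ≤ x - y :=
    (mul_le_of_le_one_left (mul_nonneg hd (by linarith)) hp1).trans
      (mul_le_of_le_one_right hd (by linarith))
  have m1 := mul_le_mul_of_nonneg_left h1 hp0
  have m2 := mul_le_mul_of_nonneg_left h2 hp0
  have m3 := mul_le_mul_of_nonneg_left h3 hp0
  have hcube : p * σ * ((σ - 1) * (σ - 2) / 6 * x ^ 3) ≤ τ ^ 3 / (6 * σ) := by
    have hc : (0 : ℝ) ≤ (σ - 1) * (σ - 2) := mul_nonneg (by linarith) (by linarith)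
    have hpow : (σ * x) ^ 3 ≤ τ ^ 3 := pow_le_pow_left₀ (by positivity) hx 3
    have hx3 : 0 ≤ x ^ 3 := by positivity
    calc p * σ * ((σ - 1) * (σ - 2) / 6 * x ^ 3)
        ≤ (σ - 1) * (σ - 2) / 6 * x ^ 3 :=
          mul_le_of_le_one_left (mul_nonneg (by linarith) hx3) hp1
      _ ≤ σ ^ 2 / 6 * x ^ 3 := mul_le_mul_of_nonneg_right (by nlinarith) hx3
      _ = (σ * x) ^ 3 / (6 * σ) := by field_simp
      _ ≤ τ ^ 3 / (6 * σ) := by gcongr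
  have hqx : p * σ * x ≤ x := mul_le_of_le_one_left hx0 hp1
  refine ⟨?_, by linarith, by linarith, by linarith⟩
  have hy1 : ((σ : ℝ) - 1) / 2 * y ≤ 1 :=
    (mul_le_mul_of_nonneg_left (by linarith) (by linarith)).trans hs1
  have := mul_nonneg hq0 (mul_nonneg hy (sub_nonneg.2 hy1))
  linarith


/-- Let `σ ≥ 2`, `p ∈ [0, 1/σ]`, `τ ∈ [0,1]`. Define `g 0 = 1 - e^{-τ/σ}`,
`g (m+1) = p·(1 - (1 - g m)^σ)`, and `ĝ 0 = g 0`, `ĝ (m+1) = pσ·(ĝ m - ((σ-1)/2)·(ĝ m)²)`.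
Then for every `m`: `0 ≤ g m - ĝ m ≤ m·τ³/(6σ)`. -/
theorem stmt_10 (σ : ℕ) (hσ : 2 ≤ σ) (p τ : ℝ) (hp : p ∈ Set.Icc (0 : ℝ) (1 / (σ : ℝ)))
    (hτ : τ ∈ Set.Icc (0 : ℝ) 1)
    (g gHat : ℕ → ℝ) (hg0 : g 0 = 1 - Real.exp (-τ / (σ : ℝ)))
    (hgrec : ∀ m : ℕ, g (m + 1) = p * (1 - (1 - g m) ^ σ))
    (hHat0 : gHat 0 = g 0)
    (hHatrec : ∀ m : ℕ,
      gHat (m + 1) = p * (σ : ℝ) * (gHat m - (((σ : ℝ) - 1) / 2) * (gHat m) ^ 2)) :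
    ∀ m : ℕ, 0 ≤ g m - gHat m ∧ g m - gHat m ≤ (m : ℝ) * τ ^ 3 / (6 * (σ : ℝ)) := by
  obtain ⟨hp0, hp1⟩ := hp
  obtain ⟨hτ0, hτ1⟩ := hτ
  have hσ0 : (0 : ℝ) < σ := by exact_mod_cast (by omega : 0 < σ)
  have hpσ : p * σ ≤ 1 := (le_div_iff₀ hσ0).1 hp1
  have key : ∀ m : ℕ, 0 ≤ gHat m ∧ gHat m ≤ g m ∧ σ * g m ≤ τ ∧
      g m - gHat m ≤ (m : ℝ) * τ ^ 3 / (6 * (σ : ℝ)) := by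
    intro m
    induction m with
    | zero =>
      rw [hHat0]
      refine ⟨?_, le_rfl, ?_, by simp⟩
      · rw [hg0, sub_nonneg, Real.exp_le_one_iff]
        exact div_nonpos_of_nonpos_of_nonneg (by linarith) hσ0.le
      · have hexp := Real.add_one_le_exp (-τ / (σ : ℝ))
        have hle : g 0 ≤ τ / σ := by rw [hg0]; rw [neg_div] at *; linarith
        rw [mul_comm]
        exact (le_div_iff₀ hσ0).1 hle
    | succ m ih =>
      obtain ⟨hy, hyx, hx, hd⟩ := ih
      obtain ⟨h1, h2, h3, h4⟩ := taylor_step_bounds hσ hp0 hpσ hτ1 hy hyx hx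
      rw [hgrec, hHatrec]
      refine ⟨h1, h2, (mul_le_mul_of_nonneg_left h3 hσ0.le).trans hx, h4.trans ?_⟩
      push_cast
      rw [add_mul, one_mul, add_div]
      linarith
  exact fun m => ⟨sub_nonneg.2 (key m).2.1, (key m).2.2.2⟩
end

section
/- Let σ ≥ 2 be an integer, δ ∈ (0,1], p = (1−δ)/σ, ρ = (σ−1)/(2σ), and τ ∈ [0,1]. Define ĝ_0 = 1 − e^{−τ/σ}, ĝ_{m+1} = pσ·(ĝ_m − ((σ−1)/2)·ĝ_m²), and g̃(t) = ĝ_0·e^{−δt} / (1 + ((1−δ)ρσ/δ)·ĝ_0·(1 − e^{−δt})). Then for every m ∈ ℕ: 0 ≤ g̃(m) − ĝ_m ≤ (δτ + τ²/2)/σ. -/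
/-- The time-one flow map of `dx/dt = -δ x - c x²` (where `E = e^{-δ}` and `k = (1 - E) / δ`)
dominates the quadratic map `x ↦ (1-δ) x - c x²`. -/
theorem quadratic_le_flow {δ c E k x y : ℝ} (hE : 1 - δ ≤ E) (hE0 : 0 ≤ E) (hc : 0 ≤ c)
    (hk : 0 ≤ k) (hk1 : k ≤ 1) (hδ : 0 ≤ δ) (hy : 0 ≤ y) (hyx : y ≤ x) :
    (1 - δ) * y - c * y ^ 2 ≤ x * E / (1 + c * k * x) := by
  have hcy : 0 ≤ c * y := mul_nonneg hc hy
  have hck : 0 ≤ c * k := mul_nonneg hc hk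
  have hDy : 0 < 1 + c * k * y := by positivity
  have hDx : 0 < 1 + c * k * x := by nlinarith
  have hmono : y * E / (1 + c * k * y) ≤ x * E / (1 + c * k * x) := by
    rw [div_le_div_iff₀ hDy hDx]
    nlinarith [mul_le_mul_of_nonneg_right hyx hE0]
  refine le_trans ?_ hmono
  rw [le_div_iff₀ hDy]
  have hqk : (1 - δ) * k ≤ 1 := by nlinarith
  have h1 : (1 - δ - c * y) * (1 + c * k * y) ≤ E := by
    nlinarith [mul_le_mul_of_nonneg_left hqk hcy, mul_nonneg hk (mul_nonneg hcy hcy)]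
  nlinarith [mul_le_mul_of_nonneg_left h1 hy]

/-- One step of the flow of `dx/dt = -δ x - c x²` decreases `x` by at least the speed at the
endpoint. -/
theorem flow_add_speed_le {δ c E k x : ℝ} (hE : (1 + δ) * E ≤ 1) (hE0 : 0 ≤ E) (hE1 : E ≤ 1)
    (hEk : E ≤ k) (hc : 0 ≤ c) (hx : 0 ≤ x) :
    x * E / (1 + c * k * x) + (δ * (x * E / (1 + c * k * x))
      + c * (x * E / (1 + c * k * x)) ^ 2) ≤ x := by
  have hk : 0 ≤ k := hE0.trans hEk
  have hcx : 0 ≤ c * x := mul_nonneg hc hx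
  have hD1 : 1 ≤ 1 + c * k * x := by nlinarith [mul_nonneg hk hcx]
  have hDeq : 1 + c * k * x = 1 + c * x * k := by ring
  rw [hDeq] at *
  set D := 1 + c * x * k with hD
  have hD0 : 0 < D := by linarith
  have h1 : (1 + δ) * E * D + c * x * E ^ 2 ≤ D ^ 2 := by
    have a1 : (1 + δ) * E * D ≤ 1 * D := mul_le_mul_of_nonneg_right hE hD0.le
    have a2 : E ^ 2 ≤ k := by nlinarith
    have a3 : c * x * E ^ 2 ≤ c * x * k := mul_le_mul_of_nonneg_left a2 hcx
    nlinarith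
  have h2 : x * E / D + (δ * (x * E / D) + c * (x * E / D) ^ 2)
      = x * (((1 + δ) * E * D + c * x * E ^ 2) / D ^ 2) := by
    field_simp
    ring
  rw [h2]
  have h3 : ((1 + δ) * E * D + c * x * E ^ 2) / D ^ 2 ≤ 1 := by
    rw [div_le_one (by positivity)]
    exact h1
  exact mul_le_of_le_one_right hx h3

/-- The explicit solution of `dx/dt = -δ x - c x²` satisfies the flow equation at time one. -/
theorem logistic_flow_step {δ c x E e : ℝ} (hδ : 0 < δ) (hc : 0 ≤ c) (hx : 0 ≤ x)
    (hE0 : 0 < E) (hE1 : E ≤ 1) (he1 : e ≤ 1) :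
    x * (e * E) / (1 + c / δ * x * (1 - e * E)) =
      (x * e / (1 + c / δ * x * (1 - e))) * E /
        (1 + c * ((1 - E) / δ) * (x * e / (1 + c / δ * x * (1 - e)))) := by
  have hA : 0 ≤ c / δ * x := by positivity
  have h1 : 0 < 1 + c / δ * x * (1 - e) := by nlinarith
  have heE : e * E ≤ 1 := by nlinarith
  have h3 : 1 + c * ((1 - E) / δ) * (x * e / (1 + c / δ * x * (1 - e)))
      = (1 + c / δ * x * (1 - e * E)) / (1 + c / δ * x * (1 - e)) := by
    rw [eq_div_iff h1.ne', add_mul, mul_assoc (c * ((1 - E) / δ)), div_mul_cancel₀ _ h1.ne']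
    ring
  rw [h3, div_mul_eq_mul_div (x * e), div_div_div_cancel_right₀ h1.ne', mul_assoc x]

/-- Let `σ ≥ 2`, `δ ∈ (0,1]`, `p = (1-δ)/σ`, `ρ = (σ-1)/(2σ)`, `τ ∈ [0,1]`. Define
`ĝ 0 = 1 - e^{-τ/σ}`, `ĝ (m+1) = pσ·(ĝ m - ((σ-1)/2)·(ĝ m)²)`, and
`g̃ t = ĝ 0 · e^{-δt} / (1 + ((1-δ)ρσ/δ)·(ĝ 0)·(1 - e^{-δt}))`. Then for every `m`:
`0 ≤ g̃ m - ĝ m ≤ (δτ + τ²/2)/σ`. -/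
theorem stmt_11 (σ : ℕ) (hσ : 2 ≤ σ) (δ p ρ τ : ℝ) (hδ : δ ∈ Set.Ioc (0 : ℝ) 1)
    (hp : p = (1 - δ) / (σ : ℝ)) (hρ : ρ = ((σ : ℝ) - 1) / (2 * (σ : ℝ)))
    (hτ : τ ∈ Set.Icc (0 : ℝ) 1)
    (gHat : ℕ → ℝ) (hHat0 : gHat 0 = 1 - Real.exp (-τ / (σ : ℝ)))
    (hHatrec : ∀ m : ℕ,
      gHat (m + 1) = p * (σ : ℝ) * (gHat m - (((σ : ℝ) - 1) / 2) * (gHat m) ^ 2))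
    (gt : ℝ → ℝ)
    (hgt : ∀ t : ℝ, gt t = gHat 0 * Real.exp (-δ * t) /
      (1 + ((1 - δ) * ρ * (σ : ℝ) / δ) * gHat 0 * (1 - Real.exp (-δ * t)))) :
    ∀ m : ℕ, 0 ≤ gt m - gHat m ∧ gt m - gHat m ≤ (δ * τ + τ ^ 2 / 2) / (σ : ℝ) := by
  obtain ⟨hδ0, hδ1⟩ := hδ
  obtain ⟨hτ0, hτ1⟩ := hτ
  have hσ2 : (2 : ℝ) ≤ σ := by exact_mod_cast hσ
  have hσ0 : (0 : ℝ) < σ := by linarith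
  have hpσ : p * (σ : ℝ) = 1 - δ := by rw [hp, div_mul_cancel₀ _ hσ0.ne']
  have hρσ : (1 - δ) * ρ * (σ : ℝ) = (1 - δ) * (((σ : ℝ) - 1) / 2) := by
    rw [hρ]
    field_simp
  obtain ⟨c, hcdef⟩ : ∃ c, c = (1 - δ) * (((σ : ℝ) - 1) / 2) := ⟨_, rfl⟩
  rw [← hcdef] at hρσ
  have hc : 0 ≤ c := by
    rw [hcdef]
    exact mul_nonneg (by linarith) (by linarith)
  have hrec : ∀ m, gHat (m + 1) = (1 - δ) * gHat m - c * gHat m ^ 2 := fun m => by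
    rw [hHatrec, hpσ, hcdef]
    ring
  have h00 : 0 ≤ gHat 0 := by
    rw [hHat0, sub_nonneg, Real.exp_le_one_iff, neg_div, neg_nonpos]
    positivity
  have h01 : gHat 0 ≤ τ / σ := by
    have := Real.add_one_le_exp (-τ / (σ : ℝ))
    rw [neg_div] at this
    rw [hHat0, neg_div]
    linarith
  have h0σ : gHat 0 * σ ≤ τ := (le_div_iff₀ hσ0).1 h01
  obtain ⟨E, hEdef⟩ : ∃ E, E = Real.exp (-δ) := ⟨_, rfl⟩
  have hE0 : 0 < E := hEdef ▸ Real.exp_pos _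
  have hE1 : E ≤ 1 := by
    rw [hEdef, Real.exp_le_one_iff]
    linarith
  have hEδ : 1 - δ ≤ E := by
    have := Real.add_one_le_exp (-δ)
    rw [hEdef]
    linarith
  have hEδ' : (1 + δ) * E ≤ 1 := by
    have h := Real.add_one_le_exp δ
    have h' : Real.exp δ * E = 1 := by rw [hEdef, ← Real.exp_add, add_neg_cancel, Real.exp_zero]
    nlinarith
  obtain ⟨k, hkdef⟩ : ∃ k, k = (1 - E) / δ := ⟨_, rfl⟩
  have hk1 : k ≤ 1 := by
    rw [hkdef, div_le_one hδ0]
    linarith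
  have hEk : E ≤ k := by
    rw [hkdef, le_div_iff₀ hδ0]
    linarith
  have hk : 0 ≤ k := hE0.le.trans hEk
  have hstep : ∀ m : ℕ, gt ((m + 1 : ℕ) : ℝ) = gt m * E / (1 + c * k * gt m) := fun m => by
    have he : Real.exp (-δ * ((m + 1 : ℕ) : ℝ)) = Real.exp (-δ * m) * E := by
      rw [hEdef, ← Real.exp_add]
      push_cast
      ring_nf
    have he1 : Real.exp (-δ * m) ≤ 1 := by
      rw [Real.exp_le_one_iff]
      have : 0 ≤ δ * m := by positivity
      linarith
    rw [hgt, hgt, hρσ, he, hkdef]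
    exact logistic_flow_step hδ0 hc h00 hE0 hE1 he1
  have hg0 : gt ((0 : ℕ) : ℝ) = gHat 0 := by simp [hgt]
  have key : ∀ m : ℕ, 0 ≤ gHat m ∧ gHat m ≤ gHat 0 ∧ gHat m ≤ gt m ∧
      gt m - gHat m ≤ (δ * gHat 0 + c * gHat 0 ^ 2) - (δ * gt m + c * gt m ^ 2) := by
    intro m
    induction m with
    | zero => simp only [hg0]; exact ⟨h00, le_rfl, le_rfl, by linarith⟩
    | succ m ih =>
      obtain ⟨i1, i2, i3, i4⟩ := ih
      have hmσ : gHat m * σ ≤ 1 := by nlinarith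
      have hcg : c * gHat m ≤ 1 - δ := by
        have : ((σ : ℝ) - 1) / 2 * gHat m ≤ 1 := by linarith
        rw [hcdef, mul_assoc]
        exact mul_le_of_le_one_right (by linarith) this
      have hcg2 : 0 ≤ c * gHat m ^ 2 := by positivity
      refine ⟨?_, ?_, ?_, ?_⟩
      · rw [hrec]
        nlinarith
      · rw [hrec]
        nlinarith [mul_nonneg hδ0.le i1]
      · rw [hrec, hstep]
        exact quadratic_le_flow hEδ hE0.le hc hk hk1 hδ0.le i1 i3
      · have h := flow_add_speed_le (x := gt m) hEδ' hE0.le hE1 hEk hc (i1.trans i3)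
        rw [← hstep] at h
        have h2 : c * gHat m ^ 2 ≤ c * gt m ^ 2 := by gcongr
        have h3 : δ * gHat m ≤ δ * gt m := by gcongr
        rw [hrec]
        linarith
  intro m
  obtain ⟨i1, -, i3, i4⟩ := key m
  refine ⟨by linarith, i4.trans ?_⟩
  have hgt0 : 0 ≤ gt m := i1.trans i3
  have h1 : 0 ≤ δ * gt m + c * gt m ^ 2 := by positivity
  have h2 : c ≤ σ / 2 := by
    rw [hcdef]
    nlinarith
  have h3 : δ * gHat 0 ≤ δ * (τ / σ) := by gcongr
  have h4 : c * gHat 0 ^ 2 ≤ σ / 2 * (τ / σ) ^ 2 := by gcongr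
  have h5 : δ * (τ / σ) + σ / 2 * (τ / σ) ^ 2 = (δ * τ + τ ^ 2 / 2) / σ := by
    field_simp
  linarith
end

section
/- Let σ ≥ 2 be an integer. For every η ∈ (0,1) there exists ε ∈ (0,1) such that for all δ, τ ∈ (0, ε), setting α = (1−δ)e^{−τ} and D = √((1−α)² + (2(σ−1)/σ)·(1−δ)²·e^{−τ}·(1 − e^{−τ})), one has D ≥ (1−η)·√τ. -/
theorem mul_exp_neg_le_one_sub_exp_neg (x : ℝ) :
    x * Real.exp (-x) ≤ 1 - Real.exp (-x) := by
  have h := mul_le_mul_of_nonneg_right (Real.add_one_le_exp x) (Real.exp_pos (-x)).le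
  rw [← Real.exp_add, add_neg_cancel, Real.exp_zero] at h
  linarith

/-- Let `σ ≥ 2`. For every `η ∈ (0,1)` there exists `ε ∈ (0,1)` such that for all
`δ, τ ∈ (0, ε)`, setting `α = (1-δ)e^{-τ}` and
`D = √((1-α)² + (2(σ-1)/σ)·(1-δ)²·e^{-τ}·(1-e^{-τ}))`, one has `D ≥ (1-η)·√τ`. -/
theorem stmt_16 (σ : ℕ) (hσ : 2 ≤ σ) :
    ∀ η : ℝ, η ∈ Set.Ioo (0 : ℝ) 1 →
      ∃ ε : ℝ, ε ∈ Set.Ioo (0 : ℝ) 1 ∧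
        ∀ δ τ : ℝ, δ ∈ Set.Ioo (0 : ℝ) ε → τ ∈ Set.Ioo (0 : ℝ) ε →
          (1 - η) * Real.sqrt τ ≤
            Real.sqrt ((1 - (1 - δ) * Real.exp (-τ)) ^ 2 +
              (2 * ((σ : ℝ) - 1) / (σ : ℝ)) * (1 - δ) ^ 2 * Real.exp (-τ) *
                (1 - Real.exp (-τ))) := by
  intro η hη
  refine ⟨η / 2, ⟨by linarith [hη.1], by linarith [hη.2]⟩, ?_⟩
  rintro δ τ ⟨hδ, hδη⟩ ⟨hτ, hτη⟩
  have hη1 : η < 1 := hη.2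
  have hcoef : (1 : ℝ) ≤ 2 * ((σ : ℝ) - 1) / σ := by
    have h2 : (2 : ℝ) ≤ σ := by exact_mod_cast hσ
    rw [le_div_iff₀ (by linarith)]
    linarith
  have hfactor : 1 - η ≤ (1 - δ) * Real.exp (-τ) := by
    nlinarith [mul_le_mul_of_nonneg_left (Real.one_sub_le_exp_neg τ)
      (by linarith : (0 : ℝ) ≤ 1 - δ), mul_pos hδ hτ]
  have hτexp := mul_exp_neg_le_one_sub_exp_neg τ
  have hexp := Real.exp_pos (-τ)
  refine Real.le_sqrt_of_sq_le ?_
  rw [mul_pow, Real.sq_sqrt hτ.le]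
  calc (1 - η) ^ 2 * τ
      ≤ ((1 - δ) * Real.exp (-τ)) ^ 2 * τ := by
        gcongr
    _ = 1 * ((1 - δ) ^ 2 * Real.exp (-τ)) * (τ * Real.exp (-τ)) := by ring
    _ ≤ 2 * ((σ : ℝ) - 1) / σ * ((1 - δ) ^ 2 * Real.exp (-τ)) * (1 - Real.exp (-τ)) := by
        gcongr
    _ = 2 * ((σ : ℝ) - 1) / σ * (1 - δ) ^ 2 * Real.exp (-τ) * (1 - Real.exp (-τ)) := by ring
    _ ≤ _ := le_add_of_nonneg_left (sq_nonneg _)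
end

section
/- Let σ ≥ 2 be an integer. There exist c > 0 and ε ∈ (0,1) such that for all δ, τ ∈ (0, ε), setting α = (1−δ)e^{−τ} and D = √((1−α)² + (2(σ−1)/σ)·(1−δ)²·e^{−τ}·(1 − e^{−τ})), one has D − (1−α) ≥ c·min(τ/δ, √τ). -/
/-- Let `σ ≥ 2`. There exist `c > 0` and `ε ∈ (0,1)` such that for all `δ, τ ∈ (0, ε)`,
setting `α = (1-δ)e^{-τ}` and `D = √((1-α)² + (2(σ-1)/σ)·(1-δ)²·e^{-τ}·(1-e^{-τ}))`,
one has `D - (1-α) ≥ c·min(τ/δ, √τ)`. -/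
theorem stmt_17 (σ : ℕ) (hσ : 2 ≤ σ) :
    ∃ c : ℝ, 0 < c ∧ ∃ ε : ℝ, ε ∈ Set.Ioo (0 : ℝ) 1 ∧
      ∀ δ τ : ℝ, δ ∈ Set.Ioo (0 : ℝ) ε → τ ∈ Set.Ioo (0 : ℝ) ε →
        c * min (τ / δ) (Real.sqrt τ) ≤
          Real.sqrt ((1 - (1 - δ) * Real.exp (-τ)) ^ 2 +
            (2 * ((σ : ℝ) - 1) / (σ : ℝ)) * (1 - δ) ^ 2 * Real.exp (-τ) *
              (1 - Real.exp (-τ))) - (1 - (1 - δ) * Real.exp (-τ)) := by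
  refine ⟨1 / 100, by norm_num, 1 / 2, by norm_num, ?_⟩
  rintro δ τ ⟨hδ, hδ'⟩ ⟨hτ, hτ'⟩
  have hσ' : (2 : ℝ) ≤ σ := by exact_mod_cast hσ
  have hk : 1 ≤ 2 * ((σ : ℝ) - 1) / σ := by
    rw [le_div_iff₀ (by linarith)]
    linarith
  have he : 1 - τ ≤ Real.exp (-τ) := Real.one_sub_le_exp_neg τ
  have hg : τ / 2 ≤ 1 - Real.exp (-τ) := by
    have h₁ : Real.exp (-τ) * Real.exp τ = 1 := by rw [← Real.exp_add]; simp
    have h₂ := Real.add_one_le_exp τ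
    nlinarith
  generalize 2 * ((σ : ℝ) - 1) / σ = k at hk ⊢
  generalize Real.exp (-τ) = e at he hg ⊢
  have hQ : τ / 16 ≤ k * (1 - δ) ^ 2 * e * (1 - e) := by
    have he₀ : 0 ≤ e := by linarith
    have hk₀ : 0 ≤ k := by linarith
    have hc : 0 ≤ k * (1 - δ) ^ 2 * e := by positivity
    calc τ / 16 = 1 * (1 / 2) ^ 2 * (1 / 2) * (τ / 2) := by ring
      _ ≤ k * (1 - δ) ^ 2 * e * (1 - e) := by
        gcongr <;> linarith
  have ha : 1 - (1 - δ) * e ≤ δ + τ := by nlinarith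
  have hm : 0 ≤ min (τ / δ) (Real.sqrt τ) := le_min (by positivity) (by positivity)
  have hmδ : min (τ / δ) (Real.sqrt τ) * δ ≤ τ := (le_div_iff₀ hδ).1 (min_le_left _ _)
  have hmτ : min (τ / δ) (Real.sqrt τ) ^ 2 ≤ τ :=
    (Real.le_sqrt hm hτ.le).1 (min_le_right _ _)
  generalize min (τ / δ) (Real.sqrt τ) = m at hm hmδ hmτ ⊢
  have hm₁ : m ≤ 1 := by nlinarith
  rw [le_sub_iff_add_le]
  apply Real.le_sqrt_of_sq_le
  have h₁ : m * τ ≤ τ := mul_le_of_le_one_left hτ.le hm₁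
  have h₂ : m * (1 - (1 - δ) * e) ≤ m * (δ + τ) := mul_le_mul_of_nonneg_left ha hm
  linarith
end

section
/- Let σ ≥ 2 be an integer. There exist c > 0, ε ∈ (0,1), and N ∈ ℕ such that for every n ≥ N, every δ ∈ (0, ε), and every τ ∈ [n^{−2}, ε], the sequence defined by g_0 = 0 and g_{m+1} = p·(1 − e^{−τ}(1 − g_m)^σ) with p = (1−δ)/σ satisfies g_n ≥ c·(D − (1−α)), where α = (1−δ)e^{−τ} and D = √((1−α)² + (2(σ−1)/σ)·(1−δ)²·e^{−τ}·(1 − e^{−τ})). -/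
/-- Second-order Bonferroni upper bound for `(1 - x) ^ k` on the unit interval. -/
theorem one_sub_pow_le_quadratic_s18 {x : ℝ} (h0 : 0 ≤ x) (h1 : x ≤ 1) (k : ℕ) :
    (1 - x) ^ k ≤ 1 - k * x + k * (k - 1) / 2 * x ^ 2 := by
  induction k with
  | zero => simp
  | succ k ih =>
    have hk : (0 : ℝ) ≤ k * (k - 1) := by
      rcases k with _ | k
      · simp
      · push_cast
        have : (0 : ℝ) ≤ k := k.cast_nonneg
        nlinarith
    have hmul := mul_le_mul_of_nonneg_right ih (sub_nonneg.2 h1)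
    have hx : 0 ≤ (k : ℝ) * (k - 1) * x ^ 3 := by positivity
    rw [pow_succ]
    push_cast
    nlinarith

/-- One step of the recursion, started above `h`, gains at least `s / (4 * k)` over `h`, as long
as `h` is below the level at which the loss terms become comparable with the source term. -/
theorem recursion_step_lower {k : ℕ} (hk : 1 ≤ k) {p q s h x : ℝ} (hq : 0 ≤ q)
    (hs : q = 1 - s) (hs0 : 0 ≤ s) (hp : 1 / (2 * (k : ℝ)) ≤ p) (hpk : p * k ≤ 1)
    (h0 : 0 ≤ h) (hx : h ≤ x) (hx1 : x ≤ 1)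
    (hloss : (1 - p * k * q) * h + k / 2 * h ^ 2 ≤ s / (4 * k)) :
    h + s / (4 * k) ≤ p * (1 - q * (1 - x) ^ k) := by
  have hk0 : (1 : ℝ) ≤ k := by exact_mod_cast hk
  have hp0 : 0 ≤ p := le_trans (by positivity) hp
  have hpow : (1 - x) ^ k ≤ 1 - k * h + k * (k - 1) / 2 * h ^ 2 :=
    (pow_le_pow_left₀ (by linarith) (by linarith) k).trans
      (one_sub_pow_le_quadratic_s18 h0 (hx.trans hx1) k)
  have hmul := mul_le_mul_of_nonneg_left hpow (mul_nonneg hp0 hq)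
  have hps : 2 * (s / (4 * k)) ≤ p * s := by
    have := mul_le_mul_of_nonneg_right hp hs0
    calc 2 * (s / (4 * k)) = 1 / (2 * (k : ℝ)) * s := by field_simp; ring
      _ ≤ _ := this
  have hpkq : p * k * q ≤ 1 := mul_le_one₀ hpk hq (by linarith)
  have hquad : p * k * q * ((k - 1) / 2 * h ^ 2) ≤ k / 2 * h ^ 2 := by
    have h1 : 0 ≤ ((k : ℝ) - 1) / 2 * h ^ 2 :=
      mul_nonneg (by linarith) (sq_nonneg h)
    have h2 := mul_le_mul_of_nonneg_right hpkq h1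
    nlinarith [sq_nonneg h]
  have hsplit : p * (1 - q) = p * s := by rw [hs]; ring
  nlinarith


/-- Let `σ ≥ 2`. There exist `c > 0`, `ε ∈ (0,1)`, and `N` such that for every `n ≥ N`,
every `δ ∈ (0, ε)`, and every `τ ∈ [n⁻², ε]`, the sequence defined by `g 0 = 0` and
`g (m+1) = p·(1 - e^{-τ}(1 - g m)^σ)` with `p = (1-δ)/σ` satisfies `g n ≥ c·(D - (1-α))`,
where `α = (1-δ)e^{-τ}` and `D = √((1-α)² + (2(σ-1)/σ)·(1-δ)²·e^{-τ}·(1-e^{-τ}))`. -/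
theorem stmt_18 (σ : ℕ) (hσ : 2 ≤ σ) :
    ∃ c : ℝ, 0 < c ∧ ∃ ε : ℝ, ε ∈ Set.Ioo (0 : ℝ) 1 ∧ ∃ N : ℕ,
      ∀ n : ℕ, N ≤ n → ∀ δ : ℝ, δ ∈ Set.Ioo (0 : ℝ) ε →
        ∀ τ : ℝ, τ ∈ Set.Icc ((n : ℝ)⁻¹ ^ 2) ε →
          ∀ g : ℕ → ℝ, g 0 = 0 →
            (∀ m : ℕ, g (m + 1) = ((1 - δ) / (σ : ℝ)) * (1 - Real.exp (-τ) * (1 - g m) ^ σ)) →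
            c * (Real.sqrt ((1 - (1 - δ) * Real.exp (-τ)) ^ 2 +
                  (2 * ((σ : ℝ) - 1) / (σ : ℝ)) * (1 - δ) ^ 2 * Real.exp (-τ) *
                    (1 - Real.exp (-τ))) -
                (1 - (1 - δ) * Real.exp (-τ))) ≤ g n := by
  have hσ2 : (2 : ℝ) ≤ σ := by exact_mod_cast hσ
  have hσ0 : (0 : ℝ) < σ := by linarith
  refine ⟨1 / (8 * σ), by positivity, 1 / 2, by norm_num, 1, ?_⟩
  rintro n hn δ ⟨hδ0, hδ⟩ τ ⟨hτn, hτ⟩ g g0 hg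
  have hn0 : (0 : ℝ) < n := by exact_mod_cast hn
  have hτ0 : 0 < τ := lt_of_lt_of_le (by positivity) hτn
  have hnτ : 1 ≤ (n : ℝ) ^ 2 * τ := by
    have := mul_le_mul_of_nonneg_left hτn (sq_nonneg (n : ℝ))
    rwa [← mul_pow, mul_inv_cancel₀ hn0.ne', one_pow] at this
  set q := Real.exp (-τ) with hq
  have hq0 : 0 < q := Real.exp_pos _
  have hq1 : q ≤ 1 := Real.exp_le_one_iff.2 (by linarith)
  obtain ⟨s, hs⟩ : ∃ s, s = 1 - q := ⟨_, rfl⟩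
  have hs0 : 0 ≤ s := by linarith
  have hsτ : τ / 2 ≤ s := by
    have h1 : q * (1 + τ) ≤ 1 := by
      have h2 : q * Real.exp τ = 1 := by rw [hq, ← Real.exp_add]; simp
      nlinarith [Real.add_one_le_exp τ]
    nlinarith
  have hpσ : (1 - δ) / (σ : ℝ) * σ = 1 - δ := by field_simp
  have hp : 1 / (2 * (σ : ℝ)) ≤ (1 - δ) / σ := by
    rw [div_le_div_iff₀ (by positivity) hσ0]
    nlinarith
  have hp1 : (1 - δ) / (σ : ℝ) ≤ 1 := by
    rw [div_le_one hσ0]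
    linarith
  have hp0 : 0 ≤ (1 - δ) / (σ : ℝ) := div_nonneg (by linarith) hσ0.le
  have hα : (1 - δ) * q ≤ 1 := by nlinarith
  set K := (2 * ((σ : ℝ) - 1) / (σ : ℝ)) * (1 - δ) ^ 2 * q with hK
  have hfac : 2 * ((σ : ℝ) - 1) / σ ≤ 2 := by
    rw [div_le_iff₀ hσ0]
    linarith
  have hfac0 : 0 ≤ 2 * ((σ : ℝ) - 1) / σ := div_nonneg (by linarith) hσ0.le
  have hK0 : 0 ≤ K := by positivity
  have hK2 : K ≤ 2 := by
    have h1 : (1 - δ) ^ 2 ≤ 1 := pow_le_one₀ (by linarith) (by linarith)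
    have h2 : (1 - δ) ^ 2 * q ≤ 1 := mul_le_one₀ h1 hq0.le hq1
    rw [hK, mul_assoc]
    nlinarith [mul_nonneg (sq_nonneg (1 - δ)) hq0.le]
  rw [← hs]
  obtain ⟨u, hu⟩ : ∃ u, u = 1 - (1 - δ) * q := ⟨_, rfl⟩
  have hu0 : 0 ≤ u := by linarith
  rw [← hu]
  have hKs : K * s ≤ 2 * s := mul_le_mul_of_nonneg_right hK2 hs0
  have hKs0 : 0 ≤ K * s := mul_nonneg hK0 hs0
  have hDsq := Real.sq_sqrt (add_nonneg (sq_nonneg u) hKs0)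
  have hDu : u ≤ √(u ^ 2 + K * s) := Real.le_sqrt_of_sq_le (by linarith)
  obtain ⟨y, hy⟩ : ∃ y, y = √(u ^ 2 + K * s) - u := ⟨_, rfl⟩
  rw [← hy]
  have hy0 : 0 ≤ y := by linarith
  have hysq : y ^ 2 + 2 * (u * y) = K * s := by
    rw [hy]
    linear_combination hDsq
  have huy0 : 0 ≤ u * y := mul_nonneg hu0 hy0
  have huy : u * y ≤ s := by linarith [sq_nonneg y]
  have hy2 : y ^ 2 ≤ 2 * s := by linarith
  have hgmem : ∀ m, 0 ≤ g m ∧ g m ≤ 1 := by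
    intro m
    induction m with
    | zero => simp [g0]
    | succ m ih =>
      have h1 : 0 ≤ (1 - g m) ^ σ := pow_nonneg (by linarith [ih.2]) _
      have h2 : (1 - g m) ^ σ ≤ 1 := pow_le_one₀ (by linarith [ih.2]) (by linarith [ih.1])
      have h3 : q * (1 - g m) ^ σ ≤ 1 := mul_le_one₀ hq1 h1 h2
      have h4 : 0 ≤ q * (1 - g m) ^ σ := mul_nonneg hq0.le h1
      rw [hg]
      exact ⟨mul_nonneg hp0 (by linarith), mul_le_one₀ hp1 (by linarith) (by linarith)⟩
  have hgrow : ∀ m : ℕ, min (1 / (8 * σ) * y) (m * (s / (4 * σ))) ≤ g m := by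
    intro m
    induction m with
    | zero => simp [g0]
    | succ m ih =>
      set h := min (1 / (8 * σ) * y) (m * (s / (4 * σ))) with hh
      have h0 : 0 ≤ h := le_min (by positivity) (by positivity)
      have hhy : h ≤ 1 / (8 * σ) * y := min_le_left _ _
      have hlin : u * h ≤ 1 / (8 * σ) * s := by
        calc u * h ≤ u * (1 / (8 * σ) * y) := mul_le_mul_of_nonneg_left hhy hu0
          _ = 1 / (8 * σ) * (u * y) := by ring
          _ ≤ _ := mul_le_mul_of_nonneg_left huy (by positivity)
      have hquad : σ / 2 * h ^ 2 ≤ 1 / (64 * σ) * s := by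
        calc σ / 2 * h ^ 2 ≤ σ / 2 * (1 / (8 * σ) * y) ^ 2 := by gcongr
          _ = 1 / (128 * σ) * y ^ 2 := by field_simp; ring
          _ ≤ 1 / (128 * σ) * (2 * s) := mul_le_mul_of_nonneg_left hy2 (by positivity)
          _ = _ := by field_simp; ring
      have hloss : (1 - (1 - δ) / (σ : ℝ) * σ * q) * h + σ / 2 * h ^ 2 ≤ s / (4 * σ) := by
        rw [hpσ, ← hu]
        have h1 : 1 / (8 * σ) * s + 1 / (64 * σ) * s ≤ s / (4 * σ) := by
          have h2 : s / (4 * σ) - (1 / (8 * σ) * s + 1 / (64 * σ) * s) = 7 * s / (64 * σ) := by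
            field_simp
            ring
          have h3 : 0 ≤ 7 * s / (64 * σ) := by positivity
          linarith
        linarith
      have hstep := recursion_step_lower (by omega) hq0.le (by linarith) hs0 hp
        (by rw [hpσ]; linarith) h0 ih (hgmem m).2 hloss
      rw [hg]
      refine le_trans ?_ hstep
      rw [hh, ← min_add_add_right]
      refine min_le_min (by linarith [show 0 ≤ s / (4 * (σ : ℝ)) by positivity]) ?_
      push_cast
      linarith
  refine le_trans (le_min le_rfl ?_) (hgrow n)
  have hyn : y ≤ 2 * n * s := by
    refine abs_le_of_sq_le_sq' ?_ (by positivity) |>.2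
    have h1 : 1 ≤ 2 * (n : ℝ) ^ 2 * s := by
      have h2 := mul_le_mul_of_nonneg_left hsτ (sq_nonneg (n : ℝ))
      linarith
    calc y ^ 2 ≤ 2 * (1 * s) := by linarith
      _ ≤ 2 * (2 * (n : ℝ) ^ 2 * s * s) := by gcongr
      _ = (2 * n * s) ^ 2 := by ring
  calc 1 / (8 * σ) * y ≤ 1 / (8 * σ) * (2 * n * s) :=
        mul_le_mul_of_nonneg_left hyn (by positivity)
    _ = n * (s / (4 * σ)) := by field_simp; ring
end
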